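/- For the 3-periodic billiard family, the sum of the cosines of the internal angles of the focus-inversive triangle is invariant and equals δ(a² + c² − δ)/(a²c²), where δ = √(a⁴ − a²b² + b⁴) and c² = a² − b². -/

import Mathlib

noncomputable section

namespace BilliardInv

/-- A point of the plane. -/
abbrev Pt := ℝ × ℝ

/-- Euclidean dot product. -/
def dot (p q : Pt) : ℝ := p.1 * q.1 + p.2 * q.2

/-- Euclidean distance. -/
def dst (p q : Pt) : ℝ := Real.sqrt ((p.1 - q.1) ^ 2 + (p.2 - q.2) ^ 2)

/-- Membership in the ellipse x²/a² + y²/b² = 1. -/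
def onEllipse (a b : ℝ) (p : Pt) : Prop := p.1 ^ 2 / a ^ 2 + p.2 ^ 2 / b ^ 2 = 1

/-- Half the gradient of f(x,y) = x²/a² + y²/b² (an outward normal direction). -/
def nrm (a b : ℝ) (p : Pt) : Pt := (p.1 / a ^ 2, p.2 / b ^ 2)

/-- Unit vector pointing from `v` toward `q`. -/
def udir (v q : Pt) : Pt := (dst v q)⁻¹ • (q - v)

/-- The billiard reflection law at vertex `v` with neighboring vertices `q`, `r`:
the two adjacent sides make equal angles with the ellipse normal at `v`. -/
def reflectAt (a b : ℝ) (q v r : Pt) : Prop :=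
  dot (udir v q) (nrm a b v) = dot (udir v r) (nrm a b v)

/-- A 3-periodic billiard orbit in the ellipse with semi-axes `a > b > 0`:
a nondegenerate triangle inscribed in the ellipse obeying the reflection
law at each vertex. -/
structure Orbit3 (a b : ℝ) : Type where
  P1 : Pt
  P2 : Pt
  P3 : Pt
  h1 : onEllipse a b P1
  h2 : onEllipse a b P2
  h3 : onEllipse a b P3
  d12 : P1 ≠ P2
  d23 : P2 ≠ P3
  d31 : P3 ≠ P1
  r1 : reflectAt a b P3 P1 P2
  r2 : reflectAt a b P1 P2 P3
  r3 : reflectAt a b P2 P3 P1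

/-- Inversion of `p` with respect to the circle of radius `ρ` centered at `f`. -/
def inva (ρ : ℝ) (f p : Pt) : Pt :=
  f + (ρ ^ 2 / ((p.1 - f.1) ^ 2 + (p.2 - f.2) ^ 2)) • (p - f)

/-- Unsigned area of a triangle. -/
def area (A B C : Pt) : ℝ :=
  |(B.1 - A.1) * (C.2 - A.2) - (B.2 - A.2) * (C.1 - A.1)| / 2

/-- The point with barycentric coordinates wA : wB : wC w.r.t. triangle ABC. -/
def bary (wA wB wC : ℝ) (A B C : Pt) : Pt :=
  (wA + wB + wC)⁻¹ • (wA • A + wB • B + wC • C)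

/-- Side length a = |BC|. -/
def sA (A B C : Pt) : ℝ := dst B C
/-- Side length b = |CA|. -/
def sB (A B C : Pt) : ℝ := dst C A
/-- Side length c = |AB|. -/
def sC (A B C : Pt) : ℝ := dst A B

/-- Incenter X(1). -/
def incenter (A B C : Pt) : Pt := bary (sA A B C) (sB A B C) (sC A B C) A B C

/-- Barycenter (centroid) X(2). -/
def centroid (A B C : Pt) : Pt := bary 1 1 1 A B C

/-- Circumcenter X(3), via its barycentric coordinates a²(b²+c²−a²) : · : ·. -/
def circumcenter (A B C : Pt) : Pt :=
  bary (sA A B C ^ 2 * (sB A B C ^ 2 + sC A B C ^ 2 - sA A B C ^ 2))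
       (sB A B C ^ 2 * (sC A B C ^ 2 + sA A B C ^ 2 - sB A B C ^ 2))
       (sC A B C ^ 2 * (sA A B C ^ 2 + sB A B C ^ 2 - sC A B C ^ 2)) A B C

/-- Orthocenter X(4) = A + B + C − 2·(circumcenter). -/
def orthocenter (A B C : Pt) : Pt := A + B + C - (2 : ℝ) • circumcenter A B C

/-- Nine-point center X(5): midpoint of circumcenter and orthocenter. -/
def ninePointCenter (A B C : Pt) : Pt :=
  ((1 : ℝ) / 2) • (circumcenter A B C + orthocenter A B C)

/-- Gergonne point X(7), barycentrics 1/(b+c−a) : 1/(c+a−b) : 1/(a+b−c). -/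
def gergonne (A B C : Pt) : Pt :=
  bary (sB A B C + sC A B C - sA A B C)⁻¹
       (sC A B C + sA A B C - sB A B C)⁻¹
       (sA A B C + sB A B C - sC A B C)⁻¹ A B C

/-- Mittenpunkt X(9), barycentrics a(b+c−a) : b(c+a−b) : c(a+b−c). -/
def mittenpunkt (A B C : Pt) : Pt :=
  bary (sA A B C * (sB A B C + sC A B C - sA A B C))
       (sB A B C * (sC A B C + sA A B C - sB A B C))
       (sC A B C * (sA A B C + sB A B C - sC A B C)) A B C

/-- Feuerbach point X(11), barycentrics (b+c−a)(b−c)² : · : ·. -/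
def feuerbach (A B C : Pt) : Pt :=
  bary ((sB A B C + sC A B C - sA A B C) * (sB A B C - sC A B C) ^ 2)
       ((sC A B C + sA A B C - sB A B C) * (sC A B C - sA A B C) ^ 2)
       ((sA A B C + sB A B C - sC A B C) * (sA A B C - sB A B C) ^ 2) A B C

/-- Triangle center X(100), barycentrics a/(b−c) : b/(c−a) : c/(a−b). -/
def X100 (A B C : Pt) : Pt :=
  bary (sA A B C / (sB A B C - sC A B C))
       (sB A B C / (sC A B C - sA A B C))
       (sC A B C / (sA A B C - sB A B C)) A B C

/-- Orthogonal projection of `Q` onto the line through `A` and `B`. -/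
def projLine (Q A B : Pt) : Pt :=
  A + (dot (Q - A) (B - A) / dot (B - A) (B - A)) • (B - A)

/-- Unsigned area of the pedal triangle of `Q` w.r.t. triangle `A B C`. -/
def pedalArea (Q A B C : Pt) : ℝ :=
  area (projLine Q A B) (projLine Q B C) (projLine Q C A)

end BilliardInv

open BilliardInv Real


/-- Final symmetric-function identity. -/
lemma fis_final (x y z g : ℝ) (hg : 3 - g ≠ 0) (h2 : x * y + y * z + z * x = -g)
    (h3 : (3 - g) * (x * y * z) = -(1 + g) * (x + y + z)) :
    ((1 - x * z) * (1 + y) + (1 - x * y) * (1 + z) - (1 - y * z) * (1 + x)) *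
    ((1 - y * z) * (1 + x) - (1 - x * z) * (1 + y) + (1 - x * y) * (1 + z)) *
    ((1 - y * z) * (1 + x) + (1 - x * z) * (1 + y) - (1 - x * y) * (1 + z)) * (1 + g) =
    ((1 - y * z) * (1 + x)) * ((1 - x * z) * (1 + y)) * ((1 - x * y) * (1 + z)) * (1 - g) ^ 2 := by
  obtain ⟨e1, he1⟩ : ∃ e, e = x + y + z := ⟨_, rfl⟩
  obtain ⟨e2, he2⟩ : ∃ e, e = x * y + y * z + z * x := ⟨_, rfl⟩
  obtain ⟨e3, he3⟩ : ∃ e, e = x * y * z := ⟨_, rfl⟩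
  obtain ⟨θ, hθ⟩ : ∃ θ, θ = e1 / (3 - g) := ⟨_, rfl⟩
  have h1' : e1 = (3 - g) * θ := by rw [hθ]; field_simp
  have h3' : e3 = -(1 + g) * θ := by
    rw [← he3, ← he1] at h3
    rw [hθ]; field_simp; linarith
  have h2' : e2 = -g := by rw [he2, h2]
  have hL : ((1 - x * z) * (1 + y) + (1 - x * y) * (1 + z) - (1 - y * z) * (1 + x)) *
    ((1 - y * z) * (1 + x) - (1 - x * z) * (1 + y) + (1 - x * y) * (1 + z)) *
    ((1 - y * z) * (1 + x) + (1 - x * z) * (1 + y) - (1 - x * y) * (1 + z)) =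
    (1 - e3 + e1 - e2) ^ 3 - 2 * (1 - e3 + e1 - e2) ^ 2 * (e1 - e2)
     + 4 * (1 - e3 + e1 - e2) * (e2 - (e1 * e2 - 3 * e3) + e3 * e1)
     - 8 * (e3 - e2 ^ 2 + 2 * e1 * e3 + e3 * e1 ^ 2 - 2 * e2 * e3 - e3 ^ 2) := by
    rw [he1, he2, he3]; ring
  have hR : ((1 - y * z) * (1 + x)) * ((1 - x * z) * (1 + y)) * ((1 - x * y) * (1 + z)) =
    (1 + e1 + e2 + e3) * (1 - e2 + e1 * e3 - e3 ^ 2) := by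
    rw [he1, he2, he3]; ring
  rw [hL, hR, h1', h2', h3']; ring

/-- Chord relation on a unit circle: a polar line meets it in two points. -/
lemma fis_chord (al be ga x y x' y' x'' y'' : ℝ)
    (h' : x' ^ 2 + y' ^ 2 = 1) (h'' : x'' ^ 2 + y'' ^ 2 = 1)
    (hd : ¬ (x' = x'' ∧ y' = y''))
    (e' : al * x * x' + be * y * y' = ga) (e'' : al * x * x'' + be * y * y'' = ga) :
    ((al * x) ^ 2 + (be * y) ^ 2) * (x' + x'') = 2 * ga * al * x ∧
    ((al * x) ^ 2 + (be * y) ^ 2) * (x' * x'') = ga ^ 2 - (be * y) ^ 2 ∧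
    ((al * x) ^ 2 + (be * y) ^ 2) * (y' * y'') = ga ^ 2 - (al * x) ^ 2 := by
  have hdet : al * x * (y' + y'') = be * y * (x' + x'') := by
    have f1 : al * x * (x' - x'') + be * y * (y' - y'') = 0 := by linear_combination e' - e''
    have f2 : (x' - x'') * (x' + x'') + (y' - y'') * (y' + y'') = 0 := by
      linear_combination h' - h''
    by_contra hne
    have hne' : al * x * (y' + y'') - be * y * (x' + x'') ≠ 0 := sub_ne_zero.mpr hne
    apply hd
    constructor
    · apply sub_eq_zero.mp
      apply (mul_eq_zero.mp _).resolve_right hne'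
      linear_combination (y' + y'') * f1 - be * y * f2
    · apply sub_eq_zero.mp
      apply (mul_eq_zero.mp _).resolve_right hne'
      linear_combination -(x' + x'') * f1 + al * x * f2
  have s1 : ((al * x) ^ 2 + (be * y) ^ 2) * (x' + x'') = 2 * ga * al * x := by
    linear_combination al * x * (e' + e'') - be * y * hdet
  have s2 : ((al * x) ^ 2 + (be * y) ^ 2) * (y' + y'') = 2 * ga * be * y := by
    linear_combination be * y * (e' + e'') + al * x * hdet
  refine ⟨s1, ?_, ?_⟩
  · linear_combination x'' * s1 - (al * x * x'' - be * y * y'' - ga) * e''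
      - (be * y) ^ 2 * h''
  · linear_combination y'' * s2 - (be * y * y'' - al * x * x'' - ga) * e''
      - (al * x) ^ 2 * h''

/-- From the bilinear relations to the closure condition and symmetric functions. -/
lemma fis_closure (al be ga x1 y1 x2 y2 x3 y3 : ℝ)
    (u1 : x1 ^ 2 + y1 ^ 2 = 1) (u2 : x2 ^ 2 + y2 ^ 2 = 1) (u3 : x3 ^ 2 + y3 ^ 2 = 1)
    (hd : ¬ (x2 = x3 ∧ y2 = y3))
    (e12 : al * x1 * x2 + be * y1 * y2 = ga) (e13 : al * x1 * x3 + be * y1 * y3 = ga)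
    (e23 : al * x2 * x3 + be * y2 * y3 = ga)
    (hbe : 0 < be) (hba : al < be) (hag : ga < al) :
    al * be + be * ga + ga * al = 0 ∧ 0 < (al * x1) ^ 2 + (be * y1) ^ 2 ∧
    ((al * x1) ^ 2 + (be * y1) ^ 2) * (x2 + x3) = 2 * ga * al * x1 ∧
    ((al * x1) ^ 2 + (be * y1) ^ 2) * (x2 * x3) = ga ^ 2 - (be * y1) ^ 2 := by
  obtain ⟨s1, p1, q1⟩ := fis_chord al be ga x1 y1 x2 y2 x3 y3 u2 u3 hd e12 e13
  refine ⟨?_, ?_, s1, p1⟩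
  · have h : (al * be + be * ga + ga * al) * ((ga - be) + (be - al) * x1 ^ 2) = 0 := by
      linear_combination (((al * x1) ^ 2 + (be * y1) ^ 2)) * e23 - al * p1 - be * q1
        + (be ^ 2 * (al + ga)) * u1
    rcases mul_eq_zero.mp h with h | h
    · exact h
    · exfalso
      nlinarith [sq_nonneg y1]
  · rcases (add_nonneg (sq_nonneg (al * x1)) (sq_nonneg (be * y1))).lt_or_eq with h | h
    · exact h
    · exfalso
      have h1 : al * x1 = 0 := by nlinarith [sq_nonneg (al * x1), sq_nonneg (be * y1)]
      have h2 : be * y1 = 0 := by nlinarith [sq_nonneg (al * x1), sq_nonneg (be * y1)]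
      have hy : y1 = 0 := (mul_eq_zero.mp h2).resolve_left hbe.ne'
      have hx : x1 ≠ 0 := by rintro rfl; rw [hy] at u1; norm_num at u1
      have ha : al = 0 := (mul_eq_zero.mp h1).resolve_right hx
      have hg : ga = 0 := by rw [← e12, h1, h2]; ring
      linarith

/-- Consequence in terms of `s`, `a`, `b`, `c`. -/
lemma fis_sym (a b c s x1 y1 x2 y2 x3 y3 : ℝ) (ha : 0 < a) (hb : 0 < b) (hc : 0 < c)
    (hs : 0 < s) (hcab : c ^ 2 = a ^ 2 - b ^ 2)
    (u1 : x1 ^ 2 + y1 ^ 2 = 1) (u2 : x2 ^ 2 + y2 ^ 2 = 1) (u3 : x3 ^ 2 + y3 ^ 2 = 1)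
    (hd : ¬ (x2 = x3 ∧ y2 = y3))
    (e12 : 1 - x1 * x2 - y1 * y2 = s * (a ^ 2 + b ^ 2 - c ^ 2 * (x1 * x2 - y1 * y2)))
    (e13 : 1 - x1 * x3 - y1 * y3 = s * (a ^ 2 + b ^ 2 - c ^ 2 * (x1 * x3 - y1 * y3)))
    (e23 : 1 - x2 * x3 - y2 * y3 = s * (a ^ 2 + b ^ 2 - c ^ 2 * (x2 * x3 - y2 * y3))) :
    ∃ g, g = s * c ^ 2 ∧ 0 < g ∧ g < 1 ∧ 4 * (s * a ^ 2) = (3 - g) * (1 + g) ∧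
      4 * (s * b ^ 2) = (3 + g) * (1 - g) ∧
      4 * (x1 * x2 + x2 * x3 + x3 * x1) = -(1 + g) * (3 - g) ∧
      4 * g * (x1 * x2 * x3) = - (1 + g) ^ 2 * (x1 + x2 + x3) := by
  obtain ⟨g, hg⟩ : ∃ g, g = s * c ^ 2 := ⟨_, rfl⟩
  have hg0 : 0 < g := by rw [hg]; positivity
  have hsb : 0 < s * b ^ 2 := by positivity
  have hsc : s * c ^ 2 = s * a ^ 2 - s * b ^ 2 := by rw [hcab]; ring
  obtain ⟨ga, hga⟩ : ∃ ga, ga = 1 - s * (a ^ 2 + b ^ 2) := ⟨_, rfl⟩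
  obtain ⟨hE, hN, hS, hP⟩ := fis_closure (1 - g) (1 + g) ga x1 y1 x2 y2 x3 y3
    u1 u2 u3 hd (by rw [hg, hga]; linear_combination -e12) (by rw [hg, hga]; linear_combination -e13)
    (by rw [hg, hga]; linear_combination -e23) (by linarith) (by linarith)
    (by rw [hga]; nlinarith)
  have hga2 : ga = -(1 - g ^ 2) / 2 := by linear_combination hE / 2
  have hsum : s * a ^ 2 + s * b ^ 2 = (3 - g ^ 2) / 2 := by
    linear_combination hga - hga2
  have hA : 4 * (s * a ^ 2) = (3 - g) * (1 + g) := by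
    linear_combination 2 * hsum - 2 * hg - 2 * hsc
  have hB : 4 * (s * b ^ 2) = (3 + g) * (1 - g) := by
    linear_combination 2 * hsum + 2 * hg + 2 * hsc
  have hg1 : g < 1 := by
    by_contra h
    nlinarith
  refine ⟨g, hg, hg0, hg1, hA, hB, ?_, ?_⟩
  · apply mul_left_cancel₀ hN.ne'
    subst hga2
    linear_combination 4 * hP + 4 * x1 * hS + (-(4 - (1+g)*(3-g)) * (1 + g) ^ 2) * u1
  · apply mul_left_cancel₀ hN.ne'
    subst hga2
    linear_combination 4 * g * x1 * hP + (1 + g) ^ 2 * hS + (1 - g ^ 2) ^ 2 * x1 * u1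

lemma fis_dst_comm (p q : Pt) : dst p q = dst q p := by
  unfold dst; congr 1; ring

lemma fis_dst_pos (p q : Pt) (h : p ≠ q) : 0 < dst p q := by
  unfold dst
  apply Real.sqrt_pos.mpr
  by_contra hn
  apply h
  have h1 : p.1 - q.1 = 0 := by nlinarith [sq_nonneg (p.1 - q.1), sq_nonneg (p.2 - q.2)]
  have h2 : p.2 - q.2 = 0 := by nlinarith [sq_nonneg (p.1 - q.1), sq_nonneg (p.2 - q.2)]
  exact Prod.ext (sub_eq_zero.mp h1) (sub_eq_zero.mp h2)

lemma fis_dst_sq (p q : Pt) : dst p q ^ 2 = (p.1 - q.1) ^ 2 + (p.2 - q.2) ^ 2 := by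
  unfold dst
  exact Real.sq_sqrt (by positivity)

lemma fis_refl (a b x y x' y' : ℝ) (ha : 0 < a) (hb : 0 < b) (h : x ^ 2 + y ^ 2 = 1) :
    dot (udir (a * x, b * y) (a * x', b * y')) (nrm a b (a * x, b * y)) =
      -((1 - x * x' - y * y') / dst (a * x, b * y) (a * x', b * y')) := by
  have hh : (a * x' - a * x) * (a * x / a ^ 2) + (b * y' - b * y) * (b * y / b ^ 2)
      = -(1 - x * x' - y * y') := by
    field_simp
    linear_combination -h
  simp only [dot, udir, nrm, Prod.smul_fst, Prod.smul_snd, Prod.fst_sub, Prod.snd_sub, smul_eq_mul]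
  have h3 : -((1 - x * x' - y * y') / dst (a * x, b * y) (a * x', b * y')) =
      (dst (a * x, b * y) (a * x', b * y'))⁻¹ * -(1 - x * x' - y * y') := by ring
  rw [h3, ← hh]
  ring

/-- squared chord length factors through the Joachimsthal quantity -/
lemma fis_bil (a b c J d x y x' y' : ℝ) (hcab : c ^ 2 = a ^ 2 - b ^ 2)
    (u : x ^ 2 + y ^ 2 = 1) (u' : x' ^ 2 + y' ^ 2 = 1)
    (hd : d ^ 2 = (a * x - a * x') ^ 2 + (b * y - b * y') ^ 2)
    (hk : 1 - x * x' - y * y' = J * d) (hpos : 0 < 1 - x * x' - y * y') :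
    1 - x * x' - y * y' = J ^ 2 * (a ^ 2 + b ^ 2 - c ^ 2 * (x * x' - y * y')) := by
  have key : d ^ 2 = (1 - x * x' - y * y') * (a ^ 2 + b ^ 2 - c ^ 2 * (x * x' - y * y')) := by
    have hx : x ^ 2 = 1 - y ^ 2 := by linarith
    have hx' : x' ^ 2 = 1 - y' ^ 2 := by linarith
    rw [hd, hcab]
    have : (a * x - a * x') ^ 2 + (b * y - b * y') ^ 2 - (1 - x * x' - y * y') * (a ^ 2 + b ^ 2 - (a ^ 2 - b ^ 2) * (x * x' - y * y')) =
      a ^ 2 * (x ^ 2 + x' ^ 2 - 1 - x ^ 2 * x' ^ 2 + y ^ 2 * y' ^ 2) +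
      b ^ 2 * (y ^ 2 + y' ^ 2 - 1 + x ^ 2 * x' ^ 2 - y ^ 2 * y' ^ 2) := by ring
    rw [← sub_eq_zero, this, hx, hx']; ring
  apply mul_left_cancel₀ hpos.ne'
  linear_combination (1 - x * x' - y * y' + J * d) * hk + J ^ 2 * key

lemma fis_kpos (x y x' y' : ℝ) (u : x ^ 2 + y ^ 2 = 1) (u' : x' ^ 2 + y' ^ 2 = 1)
    (hd : ¬ (x = x' ∧ y = y')) : 0 < 1 - x * x' - y * y' := by
  by_contra hn
  apply hd
  constructor
  · nlinarith [sq_nonneg (x - x'), sq_nonneg (y - y')]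
  · nlinarith [sq_nonneg (x - x'), sq_nonneg (y - y')]

/-- distance between inverted points -/
lemma fis_inv (ρ c r r' : ℝ) (p q : Pt) (hr : 0 < r) (hr' : 0 < r')
    (h : (p.1 + c) ^ 2 + p.2 ^ 2 = r ^ 2) (h' : (q.1 + c) ^ 2 + q.2 ^ 2 = r' ^ 2) :
    dst (inva ρ (-c, 0) p) (inva ρ (-c, 0) q) = ρ ^ 2 * dst p q / (r * r') := by
  have hs := fis_dst_sq p q
  have hn : 0 ≤ dst p q := Real.sqrt_nonneg _
  have h2 : dst (inva ρ (-c, 0) p) (inva ρ (-c, 0) q) ^ 2 = (ρ ^ 2 * dst p q / (r * r')) ^ 2 := by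
    rw [fis_dst_sq, div_pow, mul_pow _ (dst p q), hs]
    simp only [inva, Prod.fst_add, Prod.snd_add, Prod.smul_fst, Prod.smul_snd, Prod.fst_sub,
      Prod.snd_sub, smul_eq_mul, sub_neg_eq_add, sub_zero]
    rw [h, h']
    field_simp
    have e : (p.1 - q.1) ^ 2 + (p.2 - q.2) ^ 2 =
      ((p.1 + c) - (q.1 + c)) ^ 2 + (p.2 - q.2) ^ 2 := by ring
    generalize p.1 + c = X at *
    generalize q.1 + c = X' at *
    rw [e]
    linear_combination (ρ ^ 4 * r' ^ 4 - ρ ^ 4 * r ^ 2 * r' ^ 2) * h +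
      (ρ ^ 4 * r ^ 4 - ρ ^ 4 * r ^ 2 * r' ^ 2) * h'
  exact (pow_left_inj₀ (Real.sqrt_nonneg _) (by positivity) two_ne_zero).mp h2

lemma fis_dot (p q r : Pt) :
    dot (q - p) (r - p) = (dst p q ^ 2 + dst p r ^ 2 - dst q r ^ 2) / 2 := by
  simp only [fis_dst_sq, dot, Prod.fst_sub, Prod.snd_sub]; ring

lemma fis_cos (Q1 Q2 Q3 : Pt) (W A B C : ℝ) (hW : 0 < W) (hA : 0 < A) (hB : 0 < B) (hC : 0 < C)
    (h12 : dst Q1 Q2 = W * C) (h23 : dst Q2 Q3 = W * A) (h13 : dst Q1 Q3 = W * B) :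
    dot (Q2 - Q1) (Q3 - Q1) / (dst Q1 Q2 * dst Q1 Q3) +
    dot (Q3 - Q2) (Q1 - Q2) / (dst Q2 Q3 * dst Q2 Q1) +
    dot (Q1 - Q3) (Q2 - Q3) / (dst Q3 Q1 * dst Q3 Q2) =
      1 + ((B + C - A) * (A - B + C) * (A + B - C)) / (2 * (A * B * C)) := by
  rw [fis_dot, fis_dot, fis_dot, fis_dst_comm Q3 Q1, fis_dst_comm Q2 Q1, fis_dst_comm Q3 Q2,
    h12, h23, h13]
  field_simp
  ring

lemma fis_rpos (a c x y z : ℝ) (hc : 0 < c) (hca : c < a) (hu : x ^ 2 + y ^ 2 = 1)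
    (hw : c * x = a * z) : 0 < 1 + z := by
  have hx : -1 ≤ x := by nlinarith [sq_nonneg y]
  have : 0 < a * (1 + z) := by nlinarith
  exact pos_of_mul_pos_right this (hc.trans hca).le

set_option maxHeartbeats 2000000 in
/-- Core statement in normalized coordinates. -/
lemma fis_core (a b c ρ x1 y1 x2 y2 x3 y3 : ℝ) (ha : 0 < a) (hb : 0 < b) (hc : 0 < c)
    (hρ : 0 < ρ) (hcab : c ^ 2 = a ^ 2 - b ^ 2)
    (u1 : x1 ^ 2 + y1 ^ 2 = 1) (u2 : x2 ^ 2 + y2 ^ 2 = 1) (u3 : x3 ^ 2 + y3 ^ 2 = 1)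
    (P1 P2 P3 : Pt) (hP1 : P1 = (a * x1, b * y1)) (hP2 : P2 = (a * x2, b * y2))
    (hP3 : P3 = (a * x3, b * y3))
    (d12 : P1 ≠ P2) (d23 : P2 ≠ P3) (d31 : P3 ≠ P1)
    (r1 : reflectAt a b P3 P1 P2) (r2 : reflectAt a b P1 P2 P3) (Q1 Q2 Q3 : Pt)
    (hQ1 : Q1 = inva ρ (-c, 0) P1) (hQ2 : Q2 = inva ρ (-c, 0) P2) (hQ3 : Q3 = inva ρ (-c, 0) P3) :
    dot (Q2 - Q1) (Q3 - Q1) / (dst Q1 Q2 * dst Q1 Q3) +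
    dot (Q3 - Q2) (Q1 - Q2) / (dst Q2 Q3 * dst Q2 Q1) +
    dot (Q1 - Q3) (Q2 - Q3) / (dst Q3 Q1 * dst Q3 Q2) =
      Real.sqrt (a ^ 4 - a ^ 2 * b ^ 2 + b ^ 4) *
        (a ^ 2 + c ^ 2 - Real.sqrt (a ^ 4 - a ^ 2 * b ^ 2 + b ^ 4)) / (a ^ 2 * c ^ 2) := by
  have p12 := fis_dst_pos _ _ d12
  have p23 := fis_dst_pos _ _ d23
  have p31 := fis_dst_pos _ _ d31
  have q12 := fis_dst_sq P1 P2
  have q23 := fis_dst_sq P2 P3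
  have q31 := fis_dst_sq P3 P1
  have n12 : ¬ (x1 = x2 ∧ y1 = y2) := by
    rintro ⟨h, h'⟩; apply d12; rw [hP1, hP2, h, h']
  have n23 : ¬ (x2 = x3 ∧ y2 = y3) := by
    rintro ⟨h, h'⟩; apply d23; rw [hP2, hP3, h, h']
  have n31 : ¬ (x3 = x1 ∧ y3 = y1) := by
    rintro ⟨h, h'⟩; apply d31; rw [hP3, hP1, h, h']
  have k12 := fis_kpos _ _ _ _ u1 u2 n12
  have k23 := fis_kpos _ _ _ _ u2 u3 n23
  have k31 := fis_kpos _ _ _ _ u3 u1 n31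
  unfold reflectAt at r1 r2
  have R1 := r1
  have R2 := r2
  rw [hP1, hP2, hP3, fis_refl _ _ _ _ _ _ ha hb u1, fis_refl _ _ _ _ _ _ ha hb u1,
    ← hP1, ← hP2, ← hP3, fis_dst_comm P1 P3] at R1
  rw [hP1, hP2, hP3, fis_refl _ _ _ _ _ _ ha hb u2, fis_refl _ _ _ _ _ _ ha hb u2,
    ← hP1, ← hP2, ← hP3, fis_dst_comm P2 P1] at R2
  obtain ⟨J, hJ⟩ : ∃ J, J = (1 - x1 * x2 - y1 * y2) / dst P1 P2 := ⟨_, rfl⟩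
  have hJ0 : 0 < J := by rw [hJ]; positivity
  have J12 : 1 - x1 * x2 - y1 * y2 = J * dst P1 P2 := by rw [hJ]; field_simp
  have J31 : 1 - x3 * x1 - y3 * y1 = J * dst P3 P1 := by
    rw [← div_eq_iff p31.ne', hJ, ← neg_inj, ← R1]; ring
  have J23 : 1 - x2 * x3 - y2 * y3 = J * dst P2 P3 := by
    rw [← div_eq_iff p23.ne', hJ, ← neg_inj, ← R2]; ring
  have e12 := fis_bil a b c J (dst P1 P2) x1 y1 x2 y2 hcab u1 u2 (by rw [q12, hP1, hP2]) J12 k12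
  have e23 := fis_bil a b c J (dst P2 P3) x2 y2 x3 y3 hcab u2 u3 (by rw [q23, hP2, hP3]) J23 k23
  have e31 := fis_bil a b c J (dst P3 P1) x3 y3 x1 y1 hcab u3 u1 (by rw [q31, hP3, hP1]) J31 k31
  obtain ⟨s, hs⟩ : ∃ s, s = J ^ 2 := ⟨_, rfl⟩
  have hs0 : 0 < s := by rw [hs]; positivity
  rw [← hs] at e12 e23 e31
  obtain ⟨g, hg, hg0, hg1, hA, hB, hS2, hS3⟩ := fis_sym a b c s x1 y1 x2 y2 x3 y3 ha hb hc hs0 hcab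
    u1 u2 u3 n23 e12 (by linear_combination e31) e23
  -- normalized abscissas
  have hca : c < a := by
    apply lt_of_pow_lt_pow_left₀ 2 ha.le
    rw [hcab]; linarith [pow_pos hb 2]
  obtain ⟨z1, hz1⟩ : ∃ z, z = c * x1 / a := ⟨_, rfl⟩
  obtain ⟨z2, hz2⟩ : ∃ z, z = c * x2 / a := ⟨_, rfl⟩
  obtain ⟨z3, hz3⟩ : ∃ z, z = c * x3 / a := ⟨_, rfl⟩
  have w1 : c * x1 = a * z1 := by rw [hz1]; field_simp
  have w2 : c * x2 = a * z2 := by rw [hz2]; field_simp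
  have w3 : c * x3 = a * z3 := by rw [hz3]; field_simp
  have rpos : ∀ x y z : ℝ, x ^ 2 + y ^ 2 = 1 → c * x = a * z → 0 < 1 + z := by
    intro x y z hu hw
    exact fis_rpos a c x y z hc hca hu hw
  have t1 := rpos _ _ _ u1 w1
  have t2 := rpos _ _ _ u2 w2
  have t3 := rpos _ _ _ u3 w3
  have req : ∀ x y z : ℝ, x ^ 2 + y ^ 2 = 1 → c * x = a * z →
      (a * x + c) ^ 2 + (b * y) ^ 2 = (a * (1 + z)) ^ 2 := by
    intro x y z hu hw
    have : a * (1 + z) = a + c * x := by rw [hw]; ring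
    rw [this]
    linear_combination b ^ 2 * hu + (1 - x ^ 2) * hcab
  -- the sides
  have keq : ∀ x y x' y' z z' : ℝ, c * x = a * z → c * x' = a * z' →
      1 - x * x' - y * y' = s * (a ^ 2 + b ^ 2 - c ^ 2 * (x * x' - y * y')) →
      (1 + g) * (1 - x * x' - y * y') = 2 * s * a ^ 2 * (1 - z * z') := by
    intro x y x' y' z z' h h' e
    have hzz : a ^ 2 * (z * z') = c ^ 2 * (x * x') := by
      linear_combination -(c * x') * h - a * z * h'
    have : 2 * s * a ^ 2 * (1 - z * z') = 2 * s * a ^ 2 - 2 * (s * c ^ 2) * (x * x') := by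
      linear_combination -2 * s * hzz
    rw [this, ← hg]
    have e' : 1 - x * x' - y * y' = s * a ^ 2 + s * b ^ 2 - g * (x * x' - y * y') := by
      rw [e, hg]; ring
    have hcs : g = s * a ^ 2 - s * b ^ 2 := by rw [hg, hcab]; ring
    linear_combination e' + hcs
  have K12 := keq _ _ _ _ _ _ w1 w2 e12
  have K23 := keq _ _ _ _ _ _ w2 w3 e23
  have K31 := keq _ _ _ _ _ _ w3 w1 e31
  have hsa : 0 < 2 * s * a ^ 2 := by positivity
  have m12 : 0 < 1 - z1 * z2 := by
    refine pos_of_mul_pos_right (a := 2 * s * a ^ 2) ?_ hsa.le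
    rw [← K12]; positivity
  have m23 : 0 < 1 - z2 * z3 := by
    refine pos_of_mul_pos_right (a := 2 * s * a ^ 2) ?_ hsa.le
    rw [← K23]; positivity
  have m31 : 0 < 1 - z1 * z3 := by
    refine pos_of_mul_pos_right (a := 2 * s * a ^ 2) ?_ hsa.le
    rw [mul_comm z1 z3, ← K31]; positivity
  have D12 : dst P1 P2 = 2 * s * a ^ 2 * (1 - z1 * z2) / ((1 + g) * J) := by
    rw [← K12, J12]; field_simp
  have D23 : dst P2 P3 = 2 * s * a ^ 2 * (1 - z2 * z3) / ((1 + g) * J) := by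
    rw [← K23, J23]; field_simp
  have D13 : dst P1 P3 = 2 * s * a ^ 2 * (1 - z1 * z3) / ((1 + g) * J) := by
    rw [mul_comm z1 z3, ← K31, J31, fis_dst_comm P1 P3]; field_simp
  have v1 : (P1.1 + c) ^ 2 + P1.2 ^ 2 = (a * (1 + z1)) ^ 2 := by rw [hP1]; exact req _ _ _ u1 w1
  have v2 : (P2.1 + c) ^ 2 + P2.2 ^ 2 = (a * (1 + z2)) ^ 2 := by rw [hP2]; exact req _ _ _ u2 w2
  have v3 : (P3.1 + c) ^ 2 + P3.2 ^ 2 = (a * (1 + z3)) ^ 2 := by rw [hP3]; exact req _ _ _ u3 w3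
  have o1 : 0 < a * (1 + z1) := by positivity
  have o2 : 0 < a * (1 + z2) := by positivity
  have o3 : 0 < a * (1 + z3) := by positivity
  have I12 := fis_inv ρ c _ _ P1 P2 o1 o2 v1 v2
  have I23 := fis_inv ρ c _ _ P2 P3 o2 o3 v2 v3
  have I13 := fis_inv ρ c _ _ P1 P3 o1 o3 v1 v3
  rw [← hQ1, ← hQ2, D12] at I12
  rw [← hQ2, ← hQ3, D23] at I23
  rw [← hQ1, ← hQ3, D13] at I13
  rw [fis_cos Q1 Q2 Q3 (ρ ^ 2 * 2 * s / ((1 + g) * J * ((1 + z1) * (1 + z2) * (1 + z3))))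
    ((1 - z2 * z3) * (1 + z1)) ((1 - z1 * z3) * (1 + z2)) ((1 - z1 * z2) * (1 + z3))
    (by positivity) (by positivity) (by positivity) (by positivity)
    (by rw [I12]; field_simp) (by rw [I23]; field_simp) (by rw [I13]; field_simp)]
  have hZ2 : z1 * z2 + z2 * z3 + z3 * z1 = -g := by
    rw [hz1, hz2, hz3, hg]
    field_simp
    linear_combination (1 / 4 : ℝ) * hS2 + (1 / 4 : ℝ) * hA
  have hZ3 : (3 - g) * (z1 * z2 * z3) = -(1 + g) * (z1 + z2 + z3) := by
    have h1 : (1 + g) * (3 - g) * c ^ 2 = 4 * g * a ^ 2 := by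
      rw [hg] at hA ⊢
      linear_combination -c ^ 2 * hA
    have h2 : (3 - g) * c ^ 2 * (x1 * x2 * x3) = -(1 + g) * a ^ 2 * (x1 + x2 + x3) := by
      apply mul_left_cancel₀ (show 4 * g ≠ 0 by positivity)
      linear_combination (3 - g) * c ^ 2 * hS3 - (1 + g) * (x1 + x2 + x3) * h1
    rw [hz1, hz2, hz3]
    field_simp
    linear_combination h2
  have hF := fis_final z1 z2 z3 g (by linarith) hZ2 hZ3
  have hδ : Real.sqrt (a ^ 4 - a ^ 2 * b ^ 2 + b ^ 4) = (3 + g ^ 2) / (4 * s) := by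
    have : a ^ 4 - a ^ 2 * b ^ 2 + b ^ 4 = ((3 + g ^ 2) / (4 * s)) ^ 2 := by
      have ea : a ^ 2 = (3 - g) * (1 + g) / (4 * s) := by field_simp; linarith
      have eb : b ^ 2 = (3 + g) * (1 - g) / (4 * s) := by field_simp; linarith
      rw [show a ^ 4 = (a ^ 2) ^ 2 by ring, show b ^ 4 = (b ^ 2) ^ 2 by ring, ea, eb]
      field_simp
      ring
    rw [this, Real.sqrt_sq (by positivity)]
  have hRHS : (3 + g ^ 2) / (4 * s) * (a ^ 2 + c ^ 2 - (3 + g ^ 2) / (4 * s)) / (a ^ 2 * c ^ 2) =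
      1 + (1 - g) ^ 2 / (2 * (1 + g)) := by
    have ea : a ^ 2 = (3 - g) * (1 + g) / (4 * s) := by field_simp; linarith
    have ec : c ^ 2 = g / s := by rw [hg]; field_simp
    have : 0 < 3 - g := by linarith
    rw [ea, ec]
    field_simp
    ring
  rw [hδ, hRHS]
  congr 1
  rw [div_eq_div_iff (by positivity) (by positivity)]
  linear_combination 2 * hF

/-- the sum of cosines of the internal angles of the
focus-inversive triangle is invariant and equals δ(a² + c² − δ)/(a²c²). -/
theorem focus_inversive_sum_of_cosines (a b ρ : ℝ) (hab : a > b) (hb : b > 0)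
    (hρ : ρ > 0) (T : Orbit3 a b) :
    let c2 : ℝ := a ^ 2 - b ^ 2
    let δ : ℝ := Real.sqrt (a ^ 4 - a ^ 2 * b ^ 2 + b ^ 4)
    let f1 : Pt := (-Real.sqrt c2, 0)
    let Q1 := inva ρ f1 T.P1
    let Q2 := inva ρ f1 T.P2
    let Q3 := inva ρ f1 T.P3
    dot (Q2 - Q1) (Q3 - Q1) / (dst Q1 Q2 * dst Q1 Q3) +
    dot (Q3 - Q2) (Q1 - Q2) / (dst Q2 Q3 * dst Q2 Q1) +
    dot (Q1 - Q3) (Q2 - Q3) / (dst Q3 Q1 * dst Q3 Q2) =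
      δ * (a ^ 2 + c2 - δ) / (a ^ 2 * c2) := by
  intro c2 δ f1 Q1 Q2 Q3
  have ha : 0 < a := by linarith
  have hc2 : 0 < a ^ 2 - b ^ 2 := by nlinarith
  have hcs : Real.sqrt c2 ^ 2 = a ^ 2 - b ^ 2 := Real.sq_sqrt hc2.le
  have hu : ∀ p : Pt, onEllipse a b p → (p.1 / a) ^ 2 + (p.2 / b) ^ 2 = 1 := by
    intro p hp
    rw [div_pow, div_pow]; exact hp
  have hp : ∀ p : Pt, p = (a * (p.1 / a), b * (p.2 / b)) := by
    intro p
    ext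
    · simp only []; field_simp
    · simp only []; field_simp
  have h := fis_core a b (Real.sqrt c2) ρ _ _ _ _ _ _ ha hb (Real.sqrt_pos.mpr hc2) hρ hcs
    (hu _ T.h1) (hu _ T.h2) (hu _ T.h3) T.P1 T.P2 T.P3 (hp _) (hp _) (hp _)
    T.d12 T.d23 T.d31 T.r1 T.r2 Q1 Q2 Q3 rfl rfl rfl
  rw [hcs] at h
  exact h
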